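/- Let G be a vertex-weighted graph containing a path v₁v₂v₃v₄ on four distinct vertices such that d(v₂)=d(v₃)=2 and w(v₁) ≥ w(v₂) ≥ w(v₃) ≥ w(v₄). Let G' be the graph obtained from G by removing v₂ and v₃, adding the edge v₁v₄ if it is not already present, and replacing the weight of v₁ by w(v₁)+w(v₃)−w(v₂). Then α(G) = α(G') + w(v₂). -/

import Mathlib

open scoped Classical

namespace MWIS

variable {V : Type*}

/-- A finset of vertices is an independent set of `G`. -/
def IsIndepSet (G : SimpleGraph V) (s : Finset V) : Prop :=
  ∀ ⦃a⦄, a ∈ s → ∀ ⦃b⦄, b ∈ s → ¬G.Adj a b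

/-- The maximum total weight of an independent set of `G` contained in `A`
(i.e. α of the induced subgraph `G[A]`, with the inherited weights). -/
noncomputable def alphaOn [Fintype V] (G : SimpleGraph V) (w : V → ℝ) (A : Finset V) : ℝ :=
  sSup {x : ℝ | ∃ s : Finset V, s ⊆ A ∧ IsIndepSet G s ∧ x = ∑ v ∈ s, w v}

/-- The maximum total weight of an independent set of `G`. -/
noncomputable def alpha [Fintype V] (G : SimpleGraph V) (w : V → ℝ) : ℝ :=
  alphaOn G w Finset.univ

/-- The open neighborhood of a vertex, as a finset. -/
noncomputable def nbrs [Fintype V] (G : SimpleGraph V) (v : V) : Finset V :=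
  Finset.univ.filter fun u => G.Adj v u

/-- The degree of a vertex. -/
noncomputable def deg [Fintype V] (G : SimpleGraph V) (v : V) : ℕ :=
  (nbrs G v).card

/-- The closed neighborhood `N[v]` of a vertex. -/
noncomputable def closedNbrs [Fintype V] [DecidableEq V] (G : SimpleGraph V) (v : V) : Finset V :=
  insert v (nbrs G v)

/-- The open neighborhood `N(A)` of a vertex set. -/
noncomputable def openNbhd [Fintype V] [DecidableEq V] (G : SimpleGraph V) (A : Finset V) :
    Finset V :=
  (A.biUnion fun v => nbrs G v) \ A

/-- The closed neighborhood `N[A]` of a vertex set. -/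
noncomputable def closedNbhd [Fintype V] [DecidableEq V] (G : SimpleGraph V) (A : Finset V) :
    Finset V :=
  A ∪ A.biUnion fun v => nbrs G v

/-- `s` is a maximum weighted independent set of `G` with weights `w`. -/
def IsMWIS [Fintype V] (G : SimpleGraph V) (w : V → ℝ) (s : Finset V) : Prop :=
  IsIndepSet G s ∧ ∀ t : Finset V, IsIndepSet G t → ∑ v ∈ t, w v ≤ ∑ v ∈ s, w v

/-- `A` is the vertex set of a connected component of the subgraph of `G` induced on `B`:
`A` is the set of vertices reachable from some `x ∈ B` by paths staying inside `B`. -/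
def IsCompOf (G : SimpleGraph V) (B A : Finset V) : Prop :=
  ∃ x ∈ B, ∀ y, y ∈ A ↔ Relation.ReflTransGen (fun a b => a ∈ B ∧ b ∈ B ∧ G.Adj a b) x y

theorem IsIndepSet.subset {G : SimpleGraph V} {s t : Finset V} (hs : IsIndepSet G s)
    (hts : t ⊆ s) : IsIndepSet G t :=
  fun _ ha _ hb => hs (hts ha) (hts hb)

theorem IsIndepSet.insert_of_not_adj [DecidableEq V] {G : SimpleGraph V} {s : Finset V} {v : V}
    (hs : IsIndepSet G s) (hv : ∀ u ∈ s, ¬G.Adj v u) : IsIndepSet G (insert v s) := by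
  intro a ha b hb hab
  rcases Finset.mem_insert.1 ha with rfl | has <;>
    rcases Finset.mem_insert.1 hb with rfl | hbs
  · exact G.loopless.irrefl _ hab
  · exact hv b hbs hab
  · exact hv a has hab.symm
  · exact hs has hbs hab

/-- Independence after adding the single edge `ab`. -/
theorem isIndepSet_sup_edge {G : SimpleGraph V} {s : Finset V} {a b : V} (hab : a ≠ b) :
    IsIndepSet (G ⊔ SimpleGraph.fromRel fun x y => x = a ∧ y = b) s ↔
      IsIndepSet G s ∧ ¬(a ∈ s ∧ b ∈ s) := by
  simp only [IsIndepSet, SimpleGraph.sup_adj, SimpleGraph.fromRel_adj]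
  constructor
  · exact fun h => ⟨fun x hx y hy hxy => h hx hy (.inl hxy),
      fun hm => h hm.1 hm.2 (.inr ⟨hab, .inl ⟨rfl, rfl⟩⟩)⟩
  · rintro ⟨h, hm⟩ x hx y hy (hxy | ⟨-, ⟨rfl, rfl⟩ | ⟨rfl, rfl⟩⟩)
    · exact h hx hy hxy
    · exact hm ⟨hx, hy⟩
    · exact hm ⟨hy, hx⟩

theorem sum_le_alphaOn [Fintype V] {G : SimpleGraph V} {w : V → ℝ} {A s : Finset V}
    (hsA : s ⊆ A) (hs : IsIndepSet G s) : ∑ v ∈ s, w v ≤ alphaOn G w A := by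
  refine le_csSup (Set.Finite.bddAbove ?_) ⟨s, hsA, hs, rfl⟩
  refine (Set.finite_range fun t : Finset V => ∑ v ∈ t, w v).subset ?_
  rintro _ ⟨t, -, -, rfl⟩
  exact ⟨t, rfl⟩

theorem alphaOn_le [Fintype V] {G : SimpleGraph V} {w : V → ℝ} {A : Finset V} {c : ℝ}
    (h : ∀ s ⊆ A, IsIndepSet G s → ∑ v ∈ s, w v ≤ c) : alphaOn G w A ≤ c := by
  refine csSup_le ⟨_, ∅, Finset.empty_subset A, by simp [IsIndepSet], rfl⟩ ?_
  rintro _ ⟨s, hsA, hs, rfl⟩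
  exact h s hsA hs

theorem eq_or_eq_of_adj_of_deg_eq_two [Fintype V] {G : SimpleGraph V} {v a b x : V}
    (hd : deg G v = 2) (ha : G.Adj v a) (hb : G.Adj v b) (hab : a ≠ b) (hx : G.Adj v x) :
    x = a ∨ x = b := by
  have hsub : ({a, b} : Finset V) ⊆ nbrs G v := by
    simp [nbrs, Finset.insert_subset_iff, ha, hb]
  have heq := Finset.eq_of_subset_of_card_le hsub (by
    rw [Finset.card_pair hab]; exact hd.le)
  have hmem : x ∈ nbrs G v := by simp [nbrs, hx]
  simpa [← heq] using hmem

theorem sum_update_eq_add_ite [DecidableEq V] (w : V → ℝ) (a : V) (c : ℝ) (s : Finset V) :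
    ∑ v ∈ s, Function.update w a c v = ∑ v ∈ s, w v + if a ∈ s then c - w a else 0 := by
  split_ifs with ha
  · rw [Finset.sum_update_of_mem ha, Finset.sdiff_singleton_eq_erase,
      Finset.sum_erase_eq_sub ha]
    ring
  · rw [Finset.sum_update_of_notMem ha, add_zero]

/-- Deleting both ends of an edge from an independent set loses at most the larger weight. -/
theorem IsIndepSet.sum_le_sum_erase_erase_add [DecidableEq V] {G : SimpleGraph V} {w : V → ℝ}
    {s : Finset V} {a b : V} (hs : IsIndepSet G s) (hab : G.Adj a b) (ha : 0 ≤ w a)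
    (hba : w b ≤ w a) : ∑ v ∈ s, w v ≤ ∑ v ∈ (s.erase a).erase b, w v + w a := by
  by_cases has : a ∈ s
  · have hbs : b ∉ s.erase a := fun h => hs has (Finset.mem_of_mem_erase h) hab
    rw [Finset.erase_eq_of_notMem hbs, Finset.sum_erase_eq_sub has]
    linarith
  · rw [Finset.erase_eq_of_notMem has]
    by_cases hbs : b ∈ s
    · rw [Finset.sum_erase_eq_sub hbs]
      linarith
    · rw [Finset.erase_eq_of_notMem hbs]
      linarith

/-- for a path `v₁v₂v₃v₄` on four distinct vertices with
`d(v₂) = d(v₃) = 2` and `w(v₁) ≥ w(v₂) ≥ w(v₃) ≥ w(v₄)`: remove `v₂, v₃`, add the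
edge `v₁v₄`, and give `v₁` the weight `w(v₁) + w(v₃) − w(v₂)`.
Then `α(G) = α(G') + w(v₂)`. -/
theorem stmt6 [Fintype V] [DecidableEq V] (G : SimpleGraph V) (w : V → ℝ)
    (hw : ∀ x, 0 < w x) (v₁ v₂ v₃ v₄ : V)
    (h12 : v₁ ≠ v₂) (h13 : v₁ ≠ v₃) (h14 : v₁ ≠ v₄)
    (h23 : v₂ ≠ v₃) (h24 : v₂ ≠ v₄) (h34 : v₃ ≠ v₄)
    (e12 : G.Adj v₁ v₂) (e23 : G.Adj v₂ v₃) (e34 : G.Adj v₃ v₄)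
    (hd2 : deg G v₂ = 2) (hd3 : deg G v₃ = 2)
    (hw12 : w v₂ ≤ w v₁) (hw23 : w v₃ ≤ w v₂) (hw34 : w v₄ ≤ w v₃) :
    alpha G w =
      alphaOn (G ⊔ SimpleGraph.fromRel fun x y => x = v₁ ∧ y = v₄)
        (Function.update w v₁ (w v₁ + w v₃ - w v₂))
        (Finset.univ \ {v₂, v₃}) + w v₂ := by
  have hsdiff (s : Finset V) : s ⊆ Finset.univ \ {v₂, v₃} ↔ v₂ ∉ s ∧ v₃ ∉ s := by
    simp [Finset.subset_sdiff]
  apply le_antisymm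
  · refine alphaOn_le fun s _ hs => ?_
    by_cases h1 : v₁ ∈ s
    · have h2 : v₂ ∉ s := fun h2 => hs h1 h2 e12
      have hle := hs.sum_le_sum_erase_erase_add e34 (hw v₃).le hw34
      have hind : IsIndepSet G ((s.erase v₃).erase v₄) :=
        hs.subset ((Finset.erase_subset _ _).trans (Finset.erase_subset _ _))
      have hα := sum_le_alphaOn (w := Function.update w v₁ (w v₁ + w v₃ - w v₂))
        ((hsdiff ((s.erase v₃).erase v₄)).2 (by simp [h2]))
        ((isIndepSet_sup_edge h14).2 ⟨hind, by simp⟩)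
      rw [sum_update_eq_add_ite, if_pos (by simp [h1, h13, h14])] at hα
      linarith
    · have hle := hs.sum_le_sum_erase_erase_add e23 (hw v₂).le hw23
      have hind : IsIndepSet G ((s.erase v₂).erase v₃) :=
        hs.subset ((Finset.erase_subset _ _).trans (Finset.erase_subset _ _))
      have hα := sum_le_alphaOn (w := Function.update w v₁ (w v₁ + w v₃ - w v₂))
        ((hsdiff ((s.erase v₂).erase v₃)).2 (by simp))
        ((isIndepSet_sup_edge h14).2 ⟨hind, by simp [h1]⟩)
      rw [sum_update_eq_add_ite, if_neg (by simp [h1])] at hα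
      linarith
  · rw [← le_sub_iff_add_le]
    refine alphaOn_le fun s hsA hs => ?_
    obtain ⟨h2, h3⟩ := (hsdiff s).1 hsA
    obtain ⟨hs, hs14⟩ := (isIndepSet_sup_edge h14).1 hs
    rw [sum_update_eq_add_ite]
    by_cases h1 : v₁ ∈ s
    · have hind : IsIndepSet G (insert v₃ s) := hs.insert_of_not_adj fun u hu hadj => by
        rcases eq_or_eq_of_adj_of_deg_eq_two hd3 e23.symm e34 h24 hadj with rfl | rfl
        · exact h2 hu
        · exact hs14 ⟨h1, hu⟩
      have hα := sum_le_alphaOn (w := w) (Finset.subset_univ _) hind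
      rw [Finset.sum_insert h3] at hα
      rw [if_pos h1, alpha]
      linarith
    · have hind : IsIndepSet G (insert v₂ s) := hs.insert_of_not_adj fun u hu hadj => by
        rcases eq_or_eq_of_adj_of_deg_eq_two hd2 e12.symm e23 h13 hadj with rfl | rfl
        · exact h1 hu
        · exact h3 hu
      have hα := sum_le_alphaOn (w := w) (Finset.subset_univ _) hind
      rw [Finset.sum_insert h2] at hα
      rw [if_neg h1, alpha]
      linarith

end MWIS
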